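/- There exists a finite colouring of the positive rationals ℚ⁺ with the property that there is no injective sequence (x_n)_{n≥1} of positive rationals such that both (i) the set of primes that divide the denominators (in lowest terms) of the terms x_n is finite, and (ii) the set of all finite sums and finite products of the sequence, namely {∑_{i∈F} x_i : F a finite nonempty set of indices} ∪ {∏_{i∈F} x_i : F a finite nonempty set of indices}, is monochromatic. -/

import Mathlib

open Filter

lemma U_bdd (U : Ultrafilter ℕ) (f : ℕ → ℕ) (K : ℕ) (h : ∀ᶠ n in (U : Filter ℕ), f n ≤ K) :
    ∃ c, ∀ᶠ n in (U : Filter ℕ), f n = c := by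
  induction K with
  | zero => exact ⟨0, h.mono fun n hn => by omega⟩
  | succ K ih =>
    have : ∀ᶠ n in (U : Filter ℕ), f n ≤ K ∨ f n = K + 1 := h.mono fun n hn => by omega
    rcases Ultrafilter.eventually_or.1 this with h | h
    · exact ih h
    · exact ⟨_, h⟩

lemma U_dich (U : Ultrafilter ℕ) (f : ℕ → ℕ) :
    (∃ c, ∀ᶠ n in (U : Filter ℕ), f n = c) ∨ ∀ K, ∀ᶠ n in (U : Filter ℕ), K < f n := by
  by_cases h : ∀ K, ∀ᶠ n in (U : Filter ℕ), K < f n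
  · exact Or.inr h
  · push Not at h
    obtain ⟨K, hK⟩ := h
    exact Or.inl (U_bdd U f K hK)

lemma U_dichZ (U : Ultrafilter ℕ) (f : ℕ → ℤ) :
    (∃ c, ∀ᶠ n in (U : Filter ℕ), f n = c) ∨ (∀ K, ∀ᶠ n in (U : Filter ℕ), K < f n)
      ∨ (∀ K, ∀ᶠ n in (U : Filter ℕ), f n < K) := by
  rcases U_dich U (fun n => (f n).natAbs) with ⟨c, hc⟩ | h
  · have : ∀ᶠ n in (U : Filter ℕ), f n = c ∨ f n = -c := hc.mono fun n hn => by omega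
    rcases Ultrafilter.eventually_or.1 this with h | h
    · exact Or.inl ⟨_, h⟩
    · exact Or.inl ⟨_, h⟩
  · right
    have h0 : ∀ᶠ n in (U : Filter ℕ), 0 ≤ f n ∨ f n < 0 := Eventually.of_forall fun n => by omega
    rcases Ultrafilter.eventually_or.1 h0 with h0 | h0
    · left
      intro K
      filter_upwards [h0, h K.natAbs] with n h1 h2
      omega
    · right
      intro K
      filter_upwards [h0, h K.natAbs] with n h1 h2
      omega

/-- exponent of two -/
noncomputable def ee (z : ℤ) : ℕ := padicValInt 2 z

lemma ee_dvd {z : ℤ} (hz : z ≠ 0) (k : ℕ) : (2 : ℤ) ^ k ∣ z ↔ k ≤ ee z := by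
  have := padicValInt_dvd_iff (p := 2) k z
  simp only [hz, false_or] at this
  exact_mod_cast this

lemma ee_zero_dvd (z : ℤ) : (2 : ℤ) ^ (ee z) ∣ z := by
  by_cases hz : z = 0
  · simp [hz]
  · exact (ee_dvd hz _).2 le_rfl

lemma ee_eq {z : ℤ} {k : ℕ} (h1 : (2 : ℤ) ^ k ∣ z) (h2 : ¬ (2 : ℤ) ^ (k+1) ∣ z) : ee z = k := by
  have hz : z ≠ 0 := by rintro rfl; simp at h2
  rw [ee_dvd hz] at h1 h2
  omega

lemma ee_add {y z : ℤ} (hy : y ≠ 0) (h : ee y < ee z) : ee (y + z) = ee y := by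
  have h1 := ee_zero_dvd y
  have h2 : (2 : ℤ) ^ (ee y + 1) ∣ z := (pow_dvd_pow _ h).trans (ee_zero_dvd z)
  have h3 : ¬ (2 : ℤ) ^ (ee y + 1) ∣ y := by rw [ee_dvd hy]; omega
  apply ee_eq
  · exact dvd_add h1 ((pow_dvd_pow _ (Nat.le_succ _)).trans h2)
  · rwa [Int.dvd_add_left h2] 

lemma ee_two_mul {z : ℤ} (hz : z ≠ 0) : ee (2 * z) = ee z + 1 := by
  apply ee_eq
  · rw [pow_succ']; exact mul_dvd_mul_left _ (ee_zero_dvd z)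
  · rw [pow_succ']
    rw [mul_dvd_mul_iff_left (by norm_num), ee_dvd hz]; omega

lemma par_ne {k : ℕ} (h : ((k + 1 : ℕ) : ZMod 2) = (k : ZMod 2)) : False := by
  rw [ZMod.natCast_eq_natCast_iff'] at h
  omega

lemma ee_sum_same {y z : ℤ} (hy : y ≠ 0) (hz : z ≠ 0) (h : ee y = ee z)
    (hp : (ee (y + z) : ZMod 2) = ee y) : (2 : ℤ) ^ (ee y + 2) ∣ y + z := by
  by_cases h0 : y + z = 0
  · simp [h0]
  have h1 : (2 : ℤ) ^ (ee y + 1) ∣ y + z := by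
    obtain ⟨u, hu⟩ := ee_zero_dvd y
    obtain ⟨v, hv⟩ := ee_zero_dvd z
    rw [← h] at hv
    have hu2 : ¬ (2 : ℤ) ∣ u := by
      rintro ⟨w, rfl⟩
      have : (2 : ℤ) ^ (ee y + 1) ∣ y := ⟨w, by rw [pow_succ]; linarith⟩
      rw [ee_dvd hy] at this; omega
    have hv2 : ¬ (2 : ℤ) ∣ v := by
      rintro ⟨w, rfl⟩
      have : (2 : ℤ) ^ (ee y + 1) ∣ z := ⟨w, by rw [pow_succ]; linarith⟩
      rw [ee_dvd hz] at this; omega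
    obtain ⟨w, hw⟩ : (2 : ℤ) ∣ u + v := by omega
    exact ⟨w, by rw [pow_succ]; linear_combination hu + hv + 2 ^ ee y * hw⟩
  rw [ee_dvd h0] at h1 ⊢
  by_contra h2
  have : ee (y + z) = ee y + 1 := by omega
  rw [this] at hp
  exact par_ne hp

lemma ee_grow (U : Ultrafilter ℕ) (f : ℕ → ℤ) (hne : ∀ᶠ n in (U : Filter ℕ), f n ≠ 0)
    (hp : ∀ᶠ m in (U : Filter ℕ), ∀ᶠ n in (U : Filter ℕ), (ee (f m + f n) : ZMod 2) = ee (f m)) :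
    ∀ K, ∀ᶠ n in (U : Filter ℕ), K < ee (f n) := by
  rcases U_dich U (fun n => ee (f n)) with ⟨t, ht⟩ | h
  swap
  · exact h
  exfalso
  have key : ∀ᶠ m in (U : Filter ℕ), ∀ᶠ n in (U : Filter ℕ), (2 : ℤ) ^ (t + 2) ∣ f m + f n := by
    filter_upwards [hne, hp, ht] with m h1 h2 h3
    filter_upwards [hne, h2, ht] with n h4 h5 h6
    have := ee_sum_same h1 h4 (h3.trans h6.symm) h5
    rwa [h3] at this
  obtain ⟨m, ⟨hm, hmt⟩, hm0⟩ := ((key.and ht).and hne).exists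
  obtain ⟨k, hk, hmk⟩ := (key.and hm).exists
  obtain ⟨n, hkn, hmn⟩ := (hk.and hm).exists
  have h2 : (2 : ℤ) ^ (t + 2) ∣ 2 * f m := by
    have := dvd_sub (dvd_add hmk hmn) hkn
    have e : 2 * f m = f m + f k + (f m + f n) - (f k + f n) := by ring
    rwa [e]
  rw [ee_dvd (by simpa using hm0), ee_two_mul hm0, hmt] at h2
  omega

noncomputable def bb (x : ℚ) : ℤ := Int.log 2 (x ^ 2)
noncomputable def aa (x : ℚ) : ℤ := (bb x + 1) / 2

lemma bb_lo {x : ℚ} (hx : 0 < x) : (2 : ℚ) ^ (bb x) ≤ x ^ 2 := by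
  have := Int.zpow_log_le_self (b := 2) (r := x ^ 2) (by norm_num) (by positivity)
  exact_mod_cast this
lemma bb_hi (x : ℚ) : x ^ 2 < (2 : ℚ) ^ (bb x + 1) := by
  have := Int.lt_zpow_succ_log_self (b := 2) (by norm_num) (x ^ 2)
  exact_mod_cast this
lemma le_bb {x : ℚ} {k : ℤ} (h : (2 : ℚ) ^ k ≤ x ^ 2) : k ≤ bb x := by
  have := h.trans_lt (bb_hi x)
  rw [zpow_lt_zpow_iff_right₀ (by norm_num)] at this
  omega
lemma bb_lt {x : ℚ} (hx : 0 < x) {k : ℤ} (h : x ^ 2 < (2 : ℚ) ^ k) : bb x < k := by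
  have := (bb_lo hx).trans_lt h
  rwa [zpow_lt_zpow_iff_right₀ (by norm_num)] at this

lemma bb_mul {x y : ℚ} (hx : 0 < x) (hy : 0 < y) :
    bb x + bb y ≤ bb (x * y) ∧ bb (x * y) ≤ bb x + bb y + 1 := by
  have h2 : (2 : ℚ) ≠ 0 := by norm_num
  constructor
  · apply le_bb
    rw [zpow_add₀ h2, mul_pow]
    exact mul_le_mul (bb_lo hx) (bb_lo hy) (by positivity) (by positivity)
  · apply Int.lt_add_one_iff.1
    apply bb_lt (by positivity)
    have : bb x + bb y + 1 + 1 = (bb x + 1) + (bb y + 1) := by ring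
    rw [this, zpow_add₀ h2, mul_pow]
    exact mul_lt_mul'' (bb_hi x) (bb_hi y) (by positivity) (by positivity)

lemma aa_mul {x y : ℚ} (hx : 0 < x) (hy : 0 < y) (h1 : (bb x : ZMod 4) = bb y)
    (h2 : (bb (x * y) : ZMod 4) = bb y) : aa (x * y) = aa x + aa y := by
  have := bb_mul hx hy
  rw [ZMod.intCast_eq_intCast_iff'] at h1 h2
  unfold aa
  omega

lemma bb_same {x y : ℚ} (hx : 0 < x) (hy : 0 < y) (h : bb x = bb y) : bb (x + y) = bb x + 2 := by
  have h2 : (2 : ℚ) ≠ 0 := by norm_num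
  have a1 := bb_lo hx
  have a2 := bb_hi x
  have a3 := bb_lo hy
  have a4 := bb_hi y
  rw [← h] at a3 a4
  have hP : (0 : ℚ) < 2 ^ bb x := by positivity
  rw [zpow_add₀ h2] at a2 a4
  apply le_antisymm
  · apply Int.lt_add_one_iff.1
    apply bb_lt (by positivity)
    rw [add_assoc, zpow_add₀ h2]
    norm_num at a2 a4 ⊢
    nlinarith [sq_nonneg (x - y)]
  · apply le_bb
    rw [zpow_add₀ h2]
    have : (2 : ℚ) ^ bb x ≤ x * y := by
      apply le_of_sq_le_sq _ (by positivity) 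
      rw [mul_pow, sq (2 ^ bb x : ℚ)]
      exact mul_le_mul a1 a3 (by positivity) (by positivity)
    norm_num
    nlinarith

lemma bb_add_far {x y : ℚ} (hx : 0 < x) (hy : 0 < y) (h : bb x + 8 < bb y)
    (hc : (bb (x + y) : ZMod 4) = bb y) : bb (x + y) = bb y := by
  have h2 : (2 : ℚ) ≠ 0 := by norm_num
  have a2 := bb_hi x
  have a3 := bb_lo hy
  have a4 := bb_hi y
  have e1 : (2 : ℚ) ^ (bb x + 1) * 16 ≤ 2 ^ bb y := by
    calc (2 : ℚ) ^ (bb x + 1) * 16 = 2 ^ (bb x + 1 + 4) := by rw [zpow_add₀ h2 (bb x + 1)]; norm_num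
      _ ≤ _ := zpow_le_zpow_right₀ (by norm_num) (by omega)
  have hxy : 4 * x ≤ y := by
    apply le_of_sq_le_sq _ hy.le
    nlinarith
  have l1 : bb y ≤ bb (x + y) := by
    apply le_bb
    nlinarith
  have l2 : bb (x + y) < bb y + 1 + 1 := by
    apply bb_lt (by positivity)
    rw [zpow_add₀ h2 (bb y + 1)]
    norm_num
    nlinarith
  rw [ZMod.intCast_eq_intCast_iff'] at hc
  omega

lemma den_iff {p : ℕ} (hp : p.Prime) (x : ℚ) : p ∣ x.den ↔ padicValRat p x < 0 := by
  have := Fact.mk hp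
  rw [padicValRat_def]
  constructor
  · intro h
    have h1 : ¬ (p : ℤ) ∣ x.num := by
      intro h2
      have h3 : p ∣ x.num.natAbs := Int.natCast_dvd.1 h2
      exact Nat.not_coprime_of_dvd_of_dvd hp.one_lt h3 h x.reduced
    rw [padicValInt.eq_zero_of_not_dvd h1]
    have := one_le_padicValNat_of_dvd x.den_nz h
    omega
  · intro h
    by_contra h1
    rw [padicValNat.eq_zero_of_not_dvd h1] at h
    omega

lemma val_of_den {p : ℕ} (hp : p.Prime) (x : ℚ) (h : p ∣ x.den) :
    padicValRat p x = - (padicValNat p x.den : ℤ) := by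
  have h1 : ¬ (p : ℤ) ∣ x.num := by
    intro h2
    have h3 : p ∣ x.num.natAbs := Int.natCast_dvd.1 h2
    exact Nat.not_coprime_of_dvd_of_dvd hp.one_lt h3 h x.reduced
  rw [padicValRat_def, padicValInt.eq_zero_of_not_dvd h1]
  simp

noncomputable def qq (x : ℚ) : ℕ := sInf {p | p.Prime ∧ ¬ p ∣ x.den}

lemma qq_ne (x : ℚ) : {p : ℕ | p.Prime ∧ ¬ p ∣ x.den}.Nonempty := by
  obtain ⟨p, h1, h2⟩ := Nat.exists_infinite_primes (x.den + 1)
  exact ⟨p, h2, fun h => by have := Nat.le_of_dvd x.den_pos h; omega⟩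

lemma qq_mem (x : ℚ) : (qq x).Prime ∧ ¬ qq x ∣ x.den := Nat.sInf_mem (qq_ne x)

lemma qq_lt {x : ℚ} {p : ℕ} (hp : p.Prime) (h : p < qq x) : p ∣ x.den := by
  by_contra h1
  exact Nat.notMem_of_lt_sInf h ⟨hp, h1⟩

lemma qq_eq {x : ℚ} {q : ℕ} (hq : q.Prime) (h : ¬ q ∣ x.den)
    (h1 : ∀ p < q, p.Prime → p ∣ x.den) : qq x = q := by
  apply le_antisymm
  · exact Nat.sInf_le ⟨hq, h⟩
  · by_contra h2
    exact (qq_mem x).2 (h1 _ (by omega) (qq_mem x).1)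

noncomputable def VV (x : ℚ) : ℕ := padicValInt (qq x) x.num

lemma VV_eq {x : ℚ} {q : ℕ} (h : qq x = q) : (VV x : ℤ) = padicValRat q x := by
  subst h
  rw [padicValRat_def, padicValNat.eq_zero_of_not_dvd (qq_mem x).2]
  simp [VV]

noncomputable def MM (x : ℚ) : ℕ := x.den.primeFactors.sup (fun p => padicValNat p x.den)

lemma MM_ge {p : ℕ} (hp : p.Prime) (x : ℚ) : - (MM x : ℤ) ≤ padicValRat p x := by
  by_cases h : p ∣ x.den
  · rw [val_of_den hp x h]
    have : padicValNat p x.den ≤ MM x :=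
      Finset.le_sup (f := fun p => padicValNat p x.den) (Nat.mem_primeFactors.2 ⟨hp, h, x.den_nz⟩)
    omega
  · rw [den_iff hp] at h
    omega

lemma MM_ex {x : ℚ} (h : 0 < MM x) :
    ∃ p, p.Prime ∧ p ∣ x.den ∧ padicValRat p x = - (MM x : ℤ) := by
  have hne : x.den.primeFactors.Nonempty := by
    by_contra h1
    rw [Finset.not_nonempty_iff_eq_empty] at h1
    simp [MM, h1] at h
  obtain ⟨p, hp, h2⟩ := Finset.exists_mem_eq_sup _ hne (fun p => padicValNat p x.den)
  obtain ⟨hp, hd, -⟩ := Nat.mem_primeFactors.1 hp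
  exact ⟨p, hp, hd, by rw [val_of_den hp x hd, MM, h2]⟩

lemma MM_eq {x : ℚ} {k : ℕ} {p : ℕ} (hp : p.Prime) (h1 : padicValRat p x = - (k : ℤ))
    (h2 : ∀ p : ℕ, p.Prime → -(k : ℤ) ≤ padicValRat p x) : MM x = k := by
  have := MM_ge hp x
  rcases Nat.eq_zero_or_pos (MM x) with h | h
  · omega
  · obtain ⟨r, hr, -, h3⟩ := MM_ex h
    have := h2 r hr
    omega

/-- integer representative of the residue mod `q` -/
noncomputable def rz (q : ℕ) (x : ℚ) : ℤ :=
  ((x.num : ZMod q) * (x.den : ZMod q)⁻¹).valMinAbs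

lemma vma_double {q : ℕ} [NeZero q] {u : ZMod q} (hu : u ≠ 0)
    (h1 : SignType.sign (u + u).valMinAbs = SignType.sign u.valMinAbs)
    (h2 : (ee (u + u).valMinAbs : ZMod 2) = ee u.valMinAbs) : False := by
  have hz : u.valMinAbs ≠ 0 := by rwa [Ne, ZMod.valMinAbs_eq_zero]
  have hm := u.valMinAbs_mem_Ioc
  have hc := u.coe_valMinAbs
  set z := u.valMinAbs with hzdef
  simp only [Set.mem_Ioc] at hm
  by_cases hA : (2 * z) * 2 ≤ q ∧ -(q : ℤ) < (2 * z) * 2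
  · have : (u + u).valMinAbs = 2 * z := by
      rw [ZMod.valMinAbs_spec]
      refine ⟨by push_cast; rw [hc]; ring, hA.2, hA.1⟩
    rw [this, ee_two_mul hz] at h2
    exact par_ne h2
  · rcases lt_or_gt_of_ne hz with hn | hn
    · have : (u + u).valMinAbs = 2 * z + q := by
        rw [ZMod.valMinAbs_spec]
        refine ⟨by push_cast; rw [hc]; simp; ring, ?_, ?_⟩ <;> omega
      rw [sign_neg hn, this, sign_eq_neg_one_iff] at h1
      omega
    · have : (u + u).valMinAbs = 2 * z - q := by
        rw [ZMod.valMinAbs_spec]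
        refine ⟨by push_cast; rw [hc]; simp; ring, ?_, ?_⟩ <;> omega
      rw [sign_pos hn, this, sign_eq_one_iff] at h1
      omega

lemma res_add {q : ℕ} (hq : q.Prime) {x y : ℚ} (hx : ¬ q ∣ x.den) (hy : ¬ q ∣ y.den) :
    ((x + y).num : ZMod q) * ((x + y).den : ZMod q)⁻¹ =
      (x.num : ZMod q) * (x.den : ZMod q)⁻¹ + (y.num : ZMod q) * (y.den : ZMod q)⁻¹ := by
  have := Fact.mk hq
  have := Rat.cast_add_of_ne_zero (α := ZMod q) (q := x) (r := y)
    (by rwa [Ne, ZMod.natCast_eq_zero_iff]) (by rwa [Ne, ZMod.natCast_eq_zero_iff])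
  rw [Rat.cast_def, Rat.cast_def, Rat.cast_def] at this
  simpa only [div_eq_mul_inv] using this

lemma res_ne {q : ℕ} (hq : q.Prime) {x : ℚ} (hx0 : x ≠ 0) (hx : ¬ q ∣ x.den)
    (h : padicValInt q x.num = 0) :
    (x.num : ZMod q) * (x.den : ZMod q)⁻¹ ≠ 0 := by
  have := Fact.mk hq
  apply mul_ne_zero
  · rw [Ne, ZMod.intCast_zmod_eq_zero_iff_dvd]
    rw [padicValInt.eq_zero_iff] at h
    rcases h with h | h | h
    · exact absurd h hq.one_lt.ne'
    · simp [hx0] at h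
    · exact h
  · apply inv_ne_zero
    rwa [Ne, ZMod.natCast_eq_zero_iff]

abbrev Col : Type := ZMod 4 × ZMod 2 × ZMod 2 × ZMod 2 × ZMod 2 × SignType × ZMod 2 × Prop × Prop

noncomputable def col (x : ℚ) : Col :=
  ((bb x : ZMod 4), (ee (aa x) : ZMod 2), (ee (MM x) : ZMod 2), (ee (padicValRat 2 x) : ZMod 2),
    (ee (VV x) : ZMod 2), SignType.sign (rz (qq x) x), (ee (rz (qq x) x) : ZMod 2),
    VV x < ee (aa x), (aa x).natAbs < ee (MM x))

lemma col_eq {x y : ℚ} (h : col x = col y) :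
    ((bb x : ZMod 4) = bb y) ∧ ((ee (aa x) : ZMod 2) = ee (aa y)) ∧
    ((ee (MM x) : ZMod 2) = ee (MM y)) ∧
    ((ee (padicValRat 2 x) : ZMod 2) = ee (padicValRat 2 y)) ∧
    ((ee (VV x) : ZMod 2) = ee (VV y)) ∧
    (SignType.sign (rz (qq x) x) = SignType.sign (rz (qq y) y)) ∧
    ((ee (rz (qq x) x) : ZMod 2) = ee (rz (qq y) y)) ∧
    (VV x < ee (aa x) ↔ VV y < ee (aa y)) ∧
    ((aa x).natAbs < ee (MM x) ↔ (aa y).natAbs < ee (MM y)) := by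
  simpa only [col, Prod.mk.injEq, eq_iff_iff] using h

lemma den_two {p : ℕ} (hp : p.Prime) {y z w : ℚ} (h1 : ¬ p ∣ (y + z).den) (h2 : ¬ p ∣ (y + w).den)
    (h3 : ¬ p ∣ (z + w).den) : ¬ p ∣ (2 * y).den := by
  have e : 2 * y = (y + z) + (y + w) - (z + w) := by ring
  rw [e]
  intro h
  rcases hp.dvd_mul.1 (h.trans (Rat.sub_den_dvd _ _)) with h | h
  · rcases hp.dvd_mul.1 (h.trans (Rat.add_den_dvd _ _)) with h | h
    · exact h1 h
    · exact h2 h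
  · exact h3 h

lemma den_half {p : ℕ} (hp : p.Prime) {y : ℚ} (hy : y ≠ 0) (h : ¬ p ∣ (2 * y).den)
    (hd : p ∣ y.den) : p = 2 ∧ padicValRat 2 y = -1 := by
  have := Fact.mk hp
  rw [den_iff hp] at h hd
  rw [padicValRat.mul (by norm_num) hy] at h
  have e : padicValRat p (2 : ℚ) = padicValNat p 2 := by
    exact_mod_cast padicValRat.of_nat (p := p) (n := 2)
  rw [e] at h
  by_cases h2 : p = 2
  · subst h2
    have : padicValNat 2 2 = 1 := padicValNat_self
    rw [this] at h
    exact ⟨rfl, by push_cast at h; omega⟩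
  · have := Fact.mk Nat.prime_two
    rw [padicValNat_primes h2] at h
    push_cast at h
    omega

section
variable (U : Ultrafilter ℕ) (x : ℕ → ℚ)

lemma big_case (hU : ∀ m, ∀ᶠ n in (U : Filter ℕ), m ≠ n) (hpos : ∀ n, 0 < x n)
    (hfin : {p : ℕ | p.Prime ∧ ∃ n, p ∣ (x n).den}.Finite)
    (hc : ∀ m n, col (x m) = col (x n))
    (hs : ∀ m n, m ≠ n → col (x m + x n) = col (x m))
    (ht : ∀ m n, m ≠ n → col (x m * x n) = col (x m))
    (hb : ∀ K, ∀ᶠ n in (U : Filter ℕ), K < bb (x n)) : False := by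
  have hne : ∀ n, x n ≠ 0 := fun n => (hpos n).ne'
  have hsne : ∀ m n, x m + x n ≠ 0 := fun m n => (add_pos (hpos m) (hpos n)).ne'
  -- the prime q
  obtain ⟨q, hq⟩ : ∃ q, ∀ᶠ n in (U : Filter ℕ), qq (x n) = q := by
    obtain ⟨p, hp, hp2⟩ := Nat.infinite_setOfPred_prime.exists_notMem_finite hfin
    apply U_bdd U _ p
    refine Eventually.of_forall fun n => ?_
    exact Nat.sInf_le ⟨hp, fun h => hp2 ⟨hp, n, h⟩⟩
  have hqp : q.Prime := by
    obtain ⟨n, hn⟩ := hq.exists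
    exact hn ▸ (qq_mem _).1
  have hfq := Fact.mk hqp
  have hf2 := Fact.mk Nat.prime_two
  -- no cancellation
  have hnc : ∀ p < q, p.Prime → ∀ᶠ m in (U : Filter ℕ), ∀ᶠ n in (U : Filter ℕ),
      p ∣ (x m + x n).den := by
    intro p hpq hp
    by_contra hcon
    have h1 : ∀ᶠ m in (U : Filter ℕ), ∀ᶠ n in (U : Filter ℕ), ¬ p ∣ (x m + x n).den := by
      have := Ultrafilter.eventually_not.2 hcon
      exact this.mono fun m hm => Ultrafilter.eventually_not.2 hm
    have h2 : ∀ᶠ m in (U : Filter ℕ), padicValRat 2 (x m) = -1 := by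
      filter_upwards [h1, hq] with m hm hqm
      obtain ⟨k, hk, hmk⟩ := (h1.and hm).exists
      obtain ⟨n, hkn, hmn⟩ := (hk.and hm).exists
      exact (den_half hp (hne m) (den_two hp hmk hmn hkn) (qq_lt hp (by omega))).2
    have h3 := ee_grow U (fun n => padicValRat 2 (x n)) (h2.mono fun n hn => by rw [hn]; norm_num)
      (Eventually.of_forall fun m => (hU m).mono fun n hn => by
        have := (col_eq (ht m n hn)).2.2.2.1
        rwa [padicValRat.mul (hne m) (hne n)] at this) 0
    obtain ⟨n, hn, hn2⟩ := (h2.and h3).exists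
    simp only [hn] at hn2
    simp [ee, padicValInt] at hn2
  have hqs : ∀ᶠ m in (U : Filter ℕ), ∀ᶠ n in (U : Filter ℕ), qq (x m + x n) = q := by
    have h1 : ∀ᶠ m in (U : Filter ℕ), ∀ p ∈ Finset.range q, p.Prime → ∀ᶠ n in (U : Filter ℕ),
        p ∣ (x m + x n).den := by
      rw [eventually_all_finset]
      intro p hp
      by_cases h : p.Prime
      · simpa [h] using hnc p (Finset.mem_range.1 hp) h
      · simp [h]
    filter_upwards [h1, hq] with m hm hqm
    have h2 : ∀ᶠ n in (U : Filter ℕ), ∀ p ∈ Finset.range q, p.Prime →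
        p ∣ (x m + x n).den := by
      rw [eventually_all_finset]
      intro p hp
      by_cases h : p.Prime
      · simpa [h] using hm p hp h
      · simp [h]
    filter_upwards [h2, hq] with n hn hqn
    refine qq_eq hqp ?_ fun p hp hpp => hn p (Finset.mem_range.2 hp) hpp
    intro h
    rcases hqp.dvd_mul.1 (h.trans (Rat.add_den_dvd _ _)) with h | h
    · exact (qq_mem (x m)).2 (hqm ▸ h)
    · exact (qq_mem (x n)).2 (hqn ▸ h)
  have hqt : ∀ᶠ m in (U : Filter ℕ), ∀ᶠ n in (U : Filter ℕ), qq (x m * x n) = q := by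
    filter_upwards [hq] with m hqm
    filter_upwards [hq] with n hqn
    refine qq_eq hqp ?_ fun p hp hpp => ?_
    · intro h
      rcases hqp.dvd_mul.1 (h.trans (Rat.mul_den_dvd _ _)) with h | h
      · exact (qq_mem (x m)).2 (hqm ▸ h)
      · exact (qq_mem (x n)).2 (hqn ▸ h)
    · have := Fact.mk hpp
      have h1 := (den_iff hpp _).1 (qq_lt (x := x m) hpp (by omega))
      have h2 := (den_iff hpp _).1 (qq_lt (x := x n) hpp (by omega))
      rw [den_iff hpp, padicValRat.mul (hne m) (hne n)]
      omega
  have hVt : ∀ᶠ m in (U : Filter ℕ), ∀ᶠ n in (U : Filter ℕ),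
      VV (x m * x n) = VV (x m) + VV (x n) := by
    filter_upwards [hq, hqt] with m hqm h1
    filter_upwards [hq, h1] with n hqn h2
    have := VV_eq h2
    rw [padicValRat.mul (hne m) (hne n), ← VV_eq hqm, ← VV_eq hqn] at this
    exact_mod_cast this
  -- V tends to infinity
  have hV : ∀ K, ∀ᶠ n in (U : Filter ℕ), K < VV (x n) := by
    rcases U_dich U (fun n => VV (x n)) with ⟨s, hV⟩ | h
    swap
    · exact h
    exfalso
    rcases Nat.eq_zero_or_pos s with rfl | hs0
    · obtain ⟨c, hc1⟩ := U_bdd U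
        (fun n => (((x n).num : ZMod q) * ((x n).den : ZMod q)⁻¹).val) q
        (Eventually.of_forall fun n => (ZMod.val_lt _).le)
      obtain ⟨m, ⟨⟨hqm, hcm⟩, hVm⟩, hqsm⟩ := (((hq.and hc1).and hV).and hqs).exists
      obtain ⟨n, ⟨⟨hqn, hcn⟩, hmn⟩, hqsn⟩ := (((hq.and hc1).and (hU m)).and hqsm).exists
      have e := ZMod.val_injective q (hcn.trans hcm.symm)
      have dm : ¬ q ∣ (x m).den := hqm ▸ (qq_mem (x m)).2
      have dn : ¬ q ∣ (x n).den := hqn ▸ (qq_mem (x n)).2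
      have hadd := res_add hqp dm dn
      rw [e] at hadd
      obtain ⟨-, -, -, -, -, h1, h2, -⟩ := col_eq (hs m n hmn)
      rw [hqsn, hqm, rz, hadd] at h1 h2
      refine vma_double (res_ne hqp (hne m) dm ?_) h1 h2
      simpa [VV, hqm] using hVm
    · have := ee_grow U (fun n => (VV (x n) : ℤ)) (hV.mono fun n hn => by omega) (by
        filter_upwards [hVt] with m h1
        filter_upwards [h1, hU m] with n h2 hmn
        have := (col_eq (ht m n hmn)).2.2.2.2.1
        rw [h2] at this
        exact_mod_cast this) (ee s)
      obtain ⟨n, hn1, hn2⟩ := (hV.and this).exists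
      simp only [hn1] at hn2
      omega
  have hat : ∀ m n, m ≠ n → aa (x m * x n) = aa (x m) + aa (x n) := by
    intro m n hmn
    have h1 := (col_eq (ht m n hmn)).1
    have h2 := (col_eq (hc m n)).1
    exact aa_mul (hpos m) (hpos n) h2 (h1.trans h2)
  have ha0 : ∀ᶠ n in (U : Filter ℕ), aa (x n) ≠ 0 := by
    filter_upwards [hb 10] with n hn
    unfold aa
    omega
  have hE : ∀ K, ∀ᶠ n in (U : Filter ℕ), K < ee (aa (x n)) := by
    apply ee_grow U _ ha0
    refine Eventually.of_forall fun m => (hU m).mono fun n hmn => ?_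
    rw [← hat m n hmn]
    exact (col_eq (ht m n hmn)).2.1
  -- contradiction
  obtain ⟨m, ⟨⟨⟨hqm, hqsm⟩, hVtm⟩, ha0m⟩⟩ := (((hq.and hqs).and hVt).and ha0).exists
  obtain ⟨n, hqn, hqsn, hVtn, hmn, hVn, hVn2, hEn, hEn2, hbn⟩ :=
    (hq.and (hqsm.and (hVtm.and ((hU m).and ((hV (VV (x m))).and ((hV (ee (aa (x m)))).and
      ((hE (VV (x m))).and ((hE (ee (aa (x m)))).and (hb (bb (x m) + 8)))))))))).exists
  have c1 := (col_eq (hs m n hmn)).2.2.2.2.2.2.2.1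
  have c2 := (col_eq (ht m n hmn)).2.2.2.2.2.2.2.1
  have v1 : VV (x m + x n) = VV (x m) := by
    have h1 := VV_eq hqsn
    have h2 := VV_eq hqm
    have h3 := VV_eq hqn
    rw [padicValRat.add_eq_of_lt (hsne m n) (hne m) (hne n) (by omega)] at h1
    omega
  have a1 : aa (x m + x n) = aa (x n) := by
    have h1 := (col_eq (hs m n hmn)).1
    have h2 := (col_eq (hc m n)).1
    rw [aa, bb_add_far (hpos m) (hpos n) hbn (h1.trans h2), aa]
  rw [v1, a1] at c1
  rw [hVtn, hat m n hmn, ee_add ha0m hEn2] at c2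
  have := c2.2 (c1.1 hEn)
  omega

lemma small_case (hU : ∀ m, ∀ᶠ n in (U : Filter ℕ), m ≠ n) (hpos : ∀ n, 0 < x n)
    (hfin : {p : ℕ | p.Prime ∧ ∃ n, p ∣ (x n).den}.Finite)
    (hc : ∀ m n, col (x m) = col (x n))
    (hs : ∀ m n, m ≠ n → col (x m + x n) = col (x m))
    (ht : ∀ m n, m ≠ n → col (x m * x n) = col (x m))
    (hb : ∀ K, ∀ᶠ n in (U : Filter ℕ), bb (x n) < K) : False := by
  have hne : ∀ n, x n ≠ 0 := fun n => (hpos n).ne'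
  have hsne : ∀ m n, x m + x n ≠ 0 := fun m n => (add_pos (hpos m) (hpos n)).ne'
  -- M tends to infinity
  have hM : ∀ K, ∀ᶠ n in (U : Filter ℕ), K < MM (x n) := by
    rcases U_dich U (fun n => MM (x n)) with ⟨k, hk⟩ | h
    swap
    · exact h
    exfalso
    set P := hfin.toFinset with hP
    set D := ∏ p ∈ P, p ^ k with hD
    have hPp : ∀ p ∈ P, p.Prime := fun p hp => ((Set.Finite.mem_toFinset _).1 hp).1
    have hD0 : 0 < D := Finset.prod_pos fun p hp => pow_pos (hPp p hp).pos _
    have hden : ∀ᶠ n in (U : Filter ℕ), (x n).den ≤ D := by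
      filter_upwards [hk] with n hn
      have e := Nat.prod_factorization_pow_eq_self (x n).den_nz
      rw [← e, Finsupp.prod, Nat.support_factorization]
      calc ∏ p ∈ (x n).den.primeFactors, p ^ (x n).den.factorization p
          ≤ ∏ p ∈ (x n).den.primeFactors, p ^ k := by
            apply Finset.prod_le_prod' 
            intro p hp
            obtain ⟨hp, hd, -⟩ := Nat.mem_primeFactors.1 hp
            apply Nat.pow_le_pow_right hp.pos
            have h1 := MM_ge hp (x n)
            rw [val_of_den hp _ hd, hn] at h1
            rw [Nat.factorization_def _ hp]
            omega
        _ ≤ D := by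
            apply Finset.prod_le_prod_of_subset_of_one_le'
            · intro p hp
              obtain ⟨hp, hd, -⟩ := Nat.mem_primeFactors.1 hp
              exact (Set.Finite.mem_toFinset _).2 ⟨hp, n, hd⟩
            · intro p hp _
              exact Nat.one_le_pow _ _ (hPp p hp).pos
    obtain ⟨n, hn, hbn⟩ := (hden.and (hb (bb (1 / D : ℚ)))).exists
    have h1 : (1 / D : ℚ) ≤ x n := by
      have hxd : x n = (x n).num / (x n).den := (Rat.num_div_den _).symm
      rw [hxd]
      have hnum : (1 : ℚ) ≤ (x n).num := by
        exact_mod_cast Rat.num_pos.2 (hpos n)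
      have hdp : (0 : ℚ) < (x n).den := by exact_mod_cast (x n).den_pos
      have hdd : ((x n).den : ℚ) ≤ D := by exact_mod_cast hn
      exact div_le_div₀ (by linarith) hnum hdp hdd
    have hDq : (0 : ℚ) < 1 / D := by positivity
    have h2 : bb (1 / D : ℚ) ≤ bb (x n) := by
      apply le_bb
      exact (bb_lo hDq).trans (by gcongr)
    omega
  -- a common prime
  obtain ⟨p, hp, hpM⟩ : ∃ p : ℕ, p.Prime ∧
      ∀ᶠ n in (U : Filter ℕ), padicValRat p (x n) = -(MM (x n) : ℤ) := by
    have h1 : ∀ᶠ n in (U : Filter ℕ), ∃ p ∈ {p : ℕ | p.Prime ∧ ∃ n, p ∣ (x n).den},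
        padicValRat p (x n) = -(MM (x n) : ℤ) := by
      filter_upwards [hM 0] with n hn
      obtain ⟨p, hp, hd, h⟩ := MM_ex hn
      exact ⟨p, ⟨hp, n, hd⟩, h⟩
    rw [Ultrafilter.eventually_exists_mem_iff hfin] at h1
    obtain ⟨p, hp, h⟩ := h1
    exact ⟨p, hp.1, h⟩
  have hfp := Fact.mk hp
  have hMt : ∀ᶠ m in (U : Filter ℕ), ∀ᶠ n in (U : Filter ℕ),
      MM (x m * x n) = MM (x m) + MM (x n) := by
    filter_upwards [hpM] with m hm
    filter_upwards [hpM] with n hn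
    apply MM_eq hp
    · rw [padicValRat.mul (hne m) (hne n), hm, hn]
      push_cast; ring
    · intro r hr
      have := Fact.mk hr
      have h1 := MM_ge hr (x m)
      have h2 := MM_ge hr (x n)
      rw [padicValRat.mul (hne m) (hne n)]
      push_cast; omega
  have hE : ∀ K, ∀ᶠ n in (U : Filter ℕ), K < ee (MM (x n)) := by
    apply ee_grow U (fun n => (MM (x n) : ℤ)) ((hM 0).mono fun n hn => by omega)
    filter_upwards [hMt] with m h1
    filter_upwards [h1, hU m] with n h2 hmn
    have := (col_eq (ht m n hmn)).2.2.1
    rw [h2] at this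
    exact_mod_cast this
  have hat : ∀ m n, m ≠ n → aa (x m * x n) = aa (x m) + aa (x n) := by
    intro m n hmn
    have h1 := (col_eq (ht m n hmn)).1
    have h2 := (col_eq (hc m n)).1
    exact aa_mul (hpos m) (hpos n) h2 (h1.trans h2)
  obtain ⟨m, hMtm, hpm, hM0m⟩ := (hMt.and (hpM.and (hM 0))).exists
  obtain ⟨n, hpn, hMtn, hmn, hMn, hEn, hEn2, hbn, hbn2⟩ :=
    (hpM.and (hMtm.and ((hU m).and ((hM (MM (x m))).and
      ((hE (aa (x m)).natAbs).and ((hE (ee (MM (x m)))).and ((hb (bb (x m) - 8)).and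
      (hb (-2 * (ee (MM (x m)) + (aa (x m)).natAbs + 10)))))))))).exists
  have c1 := (col_eq (hs m n hmn)).2.2.2.2.2.2.2.2
  have c2 := (col_eq (ht m n hmn)).2.2.2.2.2.2.2.2
  have v1 : MM (x m + x n) = MM (x n) := by
    have h1 := MM_ge hp (x m)
    apply MM_eq hp
    · rw [add_comm, padicValRat.add_eq_of_lt (by rw [add_comm]; exact hsne m n) (hne n) (hne m)
        (by omega), hpn]
    · intro r hr
      have := Fact.mk hr
      have h1 := MM_ge hr (x m)
      have h2 := MM_ge hr (x n)
      have h3 := padicValRat.min_le_padicValRat_add (p := r) (hsne m n)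
      omega
  have a1 : aa (x m + x n) = aa (x m) := by
    have h1 := (col_eq (hs m n hmn)).1
    rw [add_comm] at h1 ⊢
    rw [aa, bb_add_far (hpos n) (hpos m) (by omega) h1, aa]
  rw [v1, a1] at c1
  rw [hMtn, hat m n hmn] at c2
  push_cast at c2
  rw [ee_add (by omega) hEn2] at c2
  have h1 := c2.2 (c1.1 hEn)
  have h2 : aa (x n) < -(ee (MM (x m)) + (aa (x m)).natAbs + 1) := by
    unfold aa at *
    omega
  omega

end

theorem stmt_11 :
    ∃ (r : ℕ) (μ : ℚ → Fin r),
      ¬ ∃ (x : ℕ → ℚ) (c : Fin r),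
        Function.Injective x ∧ (∀ n, 0 < x n) ∧
        {p : ℕ | p.Prime ∧ ∃ n, p ∣ (x n).den}.Finite ∧
        (∀ F : Finset ℕ, F.Nonempty →
          μ (∑ i ∈ F, x i) = c ∧ μ (∏ i ∈ F, x i) = c) := by
  classical
  refine ⟨Fintype.card Col, fun x => Fintype.equivFin Col (col x), ?_⟩
  rintro ⟨x, c, -, hpos, hfin, H⟩
  have h1 : ∀ n, Fintype.equivFin Col (col (x n)) = c := fun n => by
    simpa using (H {n} (by simp)).1
  have hc : ∀ m n, col (x m) = col (x n) := fun m n =>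
    (Fintype.equivFin Col).injective ((h1 m).trans (h1 n).symm)
  have hs : ∀ m n, m ≠ n → col (x m + x n) = col (x m) := fun m n hmn => by
    have := (H {m, n} (by simp)).1
    rw [Finset.sum_pair hmn] at this
    exact (Fintype.equivFin Col).injective (this.trans (h1 m).symm)
  have ht : ∀ m n, m ≠ n → col (x m * x n) = col (x m) := fun m n hmn => by
    have := (H {m, n} (by simp)).2
    rw [Finset.prod_pair hmn] at this
    exact (Fintype.equivFin Col).injective (this.trans (h1 m).symm)
  have hU : ∀ m, ∀ᶠ n in ((hyperfilter ℕ : Ultrafilter ℕ) : Filter ℕ), m ≠ n := by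
    intro m
    have := (Set.finite_singleton m).compl_mem_hyperfilter
    filter_upwards [this] with n hn
    simpa [eq_comm] using hn
  rcases U_dichZ (hyperfilter ℕ) (fun n => bb (x n)) with ⟨t, h⟩ | h | h
  · obtain ⟨m, hm⟩ := h.exists
    obtain ⟨n, hn, hmn⟩ := (h.and (hU m)).exists
    have e := bb_same (hpos m) (hpos n) (hm.trans hn.symm)
    have := (col_eq (hs m n hmn)).1
    rw [e, ZMod.intCast_eq_intCast_iff'] at this
    omega
  · exact big_case (hyperfilter ℕ) x hU hpos hfin hc hs ht h
  · exact small_case (hyperfilter ℕ) x hU hpos hfin hc hs ht h
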